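/- Let B be an N×N Hermitian negative definite complex matrix, let E be an n-dimensional subspace of ℂ^N (1 ≤ n ≤ N), and let Q be the orthogonal projector onto E. If B' is any Hermitian negative semidefinite N×N matrix with B'x = Bx for every x ∈ E, then B' ⪯ B̃[Q]. In other words, B̃[Q] is the maximal (in the Loewner order) Hermitian negative semidefinite matrix agreeing with B on E. -/

import Mathlib

open Matrix
open scoped ComplexOrder

/-- The `i`-th smallest eigenvalue (1-indexed, counted with multiplicity) of a
Hermitian matrix `H`; junk value `0` otherwise. -/
noncomputable def eig {N : ℕ} (H : Matrix (Fin N) (Fin N) ℂ) (i : ℕ) : ℝ :=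
  if hH : H.IsHermitian then
    if hi : i - 1 < N then hH.eigenvalues (Tuple.sort hH.eigenvalues ⟨i - 1, hi⟩) else 0
  else 0

/-- The adaptive compression `B̃[Q] = B (QBQ + (I-Q))⁻¹ B - B (I-Q) B`. -/
noncomputable def acomp {N : ℕ} (B Q : Matrix (Fin N) (Fin N) ℂ) : Matrix (Fin N) (Fin N) ℂ :=
  B * (Q * B * Q + (1 - Q))⁻¹ * B - B * (1 - Q) * B

/-- `Q` is a rank-`n` orthogonal projector (Hermitian, idempotent, rank `n`). -/
def IsProjOfRank {N : ℕ} (n : ℕ) (Q : Matrix (Fin N) (Fin N) ℂ) : Prop :=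
  Q.IsHermitian ∧ Q * Q = Q ∧ Q.rank = n

/-- `R` is a bottom-`n` eigenprojector of the Hermitian matrix `H`: a rank-`n`
orthogonal projector commuting with `H` whose range lies in the span of eigenvectors
for the `n` smallest eigenvalues, i.e. `x*Hx ≤ λ_n{H}·x*x` on the range of `R`. -/
def IsBottomEigenproj {N : ℕ} (n : ℕ) (H R : Matrix (Fin N) (Fin N) ℂ) : Prop :=
  IsProjOfRank n R ∧ H * R = R * H ∧
    ∀ x : Fin N → ℂ, (∃ y, x = R.mulVec y) →
      (star x ⬝ᵥ H.mulVec x).re ≤ eig H n * (star x ⬝ᵥ x).re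

/-- The spectral (operator) norm of a complex matrix: the operator norm of the
associated linear map on Euclidean space. -/
noncomputable def specNorm {N : ℕ} (M : Matrix (Fin N) (Fin N) ℂ) : ℝ :=
  ‖LinearMap.toContinuousLinearMap (Matrix.toEuclideanLin M)‖

/-- The compression of a negative definite matrix to the range of a projector, completed by the
complementary projector, is invertible. -/
theorem isUnit_compression_add_compl {N : ℕ} {B Q : Matrix (Fin N) (Fin N) ℂ} (hB : (-B).PosDef)
    (hQh : Q.IsHermitian) (hQQ : Q * Q = Q) : IsUnit (Q * B * Q + (1 - Q)) := by
  rw [← Matrix.mulVec_injective_iff_isUnit, ← Matrix.coe_mulVecLin, ← LinearMap.ker_eq_bot,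
    LinearMap.ker_eq_bot']
  intro x hx
  rw [Matrix.mulVecLin_apply] at hx
  have hQx : Q *ᵥ x = x := by
    have h : ((1 - Q) * (Q * B * Q + (1 - Q))) *ᵥ x = 0 := by
      rw [← Matrix.mulVec_mulVec, hx, Matrix.mulVec_zero]
    have hcompl : (1 - Q) * (Q * B * Q + (1 - Q)) = 1 - Q := by
      linear_combination (norm := noncomm_ring) hQQ - hQQ * (B * Q)
    rw [hcompl, Matrix.sub_mulVec, Matrix.one_mulVec, sub_eq_zero] at h
    exact h.symm
  have hQBx : Q *ᵥ (B *ᵥ x) = 0 := by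
    rwa [Matrix.add_mulVec, Matrix.sub_mulVec, Matrix.one_mulVec, hQx, sub_self, add_zero,
      ← Matrix.mulVec_mulVec, ← Matrix.mulVec_mulVec, hQx] at hx
  have hstar : star x = star x ᵥ* Q := by
    conv_lhs => rw [← hQx, Matrix.star_mulVec, hQh.eq]
  by_contra hne
  have hpos := hB.dotProduct_mulVec_pos hne
  rw [hstar, ← Matrix.dotProduct_mulVec, Matrix.neg_mulVec, Matrix.mulVec_neg, hQBx] at hpos
  simp at hpos

/-- A matrix agreeing with `B` on the fixed vectors of an idempotent `Q` satisfies
`B' * Q = B * Q`. -/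
theorem mul_eq_mul_of_agree {N : ℕ} {B B' Q : Matrix (Fin N) (Fin N) ℂ} (hQQ : Q * Q = Q)
    (h : ∀ x : Fin N → ℂ, Q *ᵥ x = x → B' *ᵥ x = B *ᵥ x) : B' * Q = B * Q := by
  refine Matrix.ext_of_mulVec_single fun i => ?_
  rw [← Matrix.mulVec_mulVec, ← Matrix.mulVec_mulVec]
  exact h _ (by rw [Matrix.mulVec_mulVec, hQQ])

/-- The adaptive compression is `B * S * B` for a Hermitian generalized inverse `S` of the
compression `Q * B * Q`. -/
theorem exists_acomp_eq {N : ℕ} {B Q : Matrix (Fin N) (Fin N) ℂ} (hB : (-B).PosDef)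
    (hQh : Q.IsHermitian) (hQQ : Q * Q = Q) :
    ∃ S : Matrix (Fin N) (Fin N) ℂ, S.IsHermitian ∧ Q * S = S ∧ S * Q = S ∧ S * B * S = S ∧
      acomp B Q = B * S * B := by
  have hBh : B.IsHermitian := by simpa using hB.isHermitian.neg
  set M := Q * B * Q + (1 - Q) with hM
  have hdet : IsUnit M.det :=
    (Matrix.isUnit_iff_isUnit_det _).1 (isUnit_compression_add_compl hB hQh hQQ)
  have hMh : M.IsHermitian := by
    simp [Matrix.IsHermitian, hM, Matrix.conjTranspose_mul, hQh.eq, hBh.eq, Matrix.mul_assoc]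
  have hK : M * M⁻¹ = 1 := Matrix.mul_nonsing_inv _ hdet
  have hK' : M⁻¹ * M = 1 := Matrix.nonsing_inv_mul _ hdet
  have hQM : (1 - Q) * M = 1 - Q := by
    rw [hM]; linear_combination (norm := noncomm_ring) hQQ - hQQ * (B * Q)
  have hMQ : M * (1 - Q) = 1 - Q := by
    rw [hM]; linear_combination (norm := noncomm_ring) hQQ - (Q * B) * hQQ
  have hl : (1 - Q) * M⁻¹ = 1 - Q := by
    conv_lhs => rw [← hQM, Matrix.mul_assoc, hK, Matrix.mul_one]
  have hr : M⁻¹ * (1 - Q) = 1 - Q := by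
    conv_lhs => rw [← hMQ, ← Matrix.mul_assoc, hK', Matrix.one_mul]
  set S := M⁻¹ - (1 - Q) with hS
  have hQS : Q * S = S := by
    rw [hS]; linear_combination (norm := noncomm_ring) hQQ - hl
  have hSQ : S * Q = S := by
    rw [hS]; linear_combination (norm := noncomm_ring) hQQ - hr
  refine ⟨S, hMh.inv.sub (Matrix.isHermitian_one.sub hQh), hQS, hSQ, ?_, ?_⟩
  · have hSBS : S * B * S = S * (M - (1 - Q)) * S := by
      calc S * B * S = (S * Q) * B * (Q * S) := by rw [hSQ, hQS]
        _ = S * (M - (1 - Q)) * S := by rw [hM]; noncomm_ring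
    have hMS : (M - (1 - Q)) * S = Q := by
      rw [hS]; linear_combination (norm := noncomm_ring) hK - hl - hMQ + hQQ
    rw [hSBS, Matrix.mul_assoc, hMS, hSQ]
  · rw [acomp, ← hM, hS]; noncomm_ring

/-- **Axiomatic characterization II (Prop. `axiomaticII`).** For `B` Hermitian negative
definite and `Q` the rank-`n` orthogonal projector onto an `n`-dimensional subspace `E`
(the range of `Q`, i.e. the fixed vectors of `Q`), the adaptive compression `B̃[Q]` is the
maximal Hermitian negative semidefinite matrix agreeing with `B` on `E`: any Hermitian
negative semidefinite `B'` with `B'x = Bx` for all `x ∈ E` satisfies `B' ⪯ B̃[Q]`. -/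
theorem acomp_maximal_negsemidef {N n : ℕ} (hn1 : 1 ≤ n) (hnN : n ≤ N)
    (B : Matrix (Fin N) (Fin N) ℂ) (hB : (-B).PosDef)
    (Q : Matrix (Fin N) (Fin N) ℂ) (hQ : IsProjOfRank n Q)
    (B' : Matrix (Fin N) (Fin N) ℂ) (hB'h : B'.IsHermitian) (hB'neg : (-B').PosSemidef)
    (hagree : ∀ x : Fin N → ℂ, Q.mulVec x = x → B'.mulVec x = B.mulVec x) :
    (acomp B Q - B').PosSemidef := by
  obtain ⟨hQh, hQQ, -⟩ := hQ
  have hBh : B.IsHermitian := by simpa using hB.isHermitian.neg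
  obtain ⟨S, hSh, hQS, hSQ, hSBS, hA⟩ := exists_acomp_eq hB hQh hQQ
  have hBQ : B' * Q = B * Q := mul_eq_mul_of_agree hQQ hagree
  have hB'S : B' * S = B * S := by rw [← hQS, ← Matrix.mul_assoc, hBQ, Matrix.mul_assoc]
  have hSB' : S * B' = S * B := by
    simpa [Matrix.conjTranspose_mul, hSh.eq, hBh.eq, hB'h.eq] using congrArg conjTranspose hB'S
  have hT : (1 - S * B)ᴴ = 1 - B * S := by
    simp [Matrix.conjTranspose_mul, hSh.eq, hBh.eq]
  have hcongr : acomp B Q - B' = (1 - S * B)ᴴ * (-B') * (1 - S * B) := by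
    rw [hA, hT]
    linear_combination (norm := noncomm_ring)
      B * hSB' * (S * B) - hB'S * B - B * hSB' + B * hSBS * B
  rw [hcongr]
  exact hB'neg.conjTranspose_mul_mul_same _
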